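/- Fix p∈ℕ+ and ε>0, and set d=36p(2p+1), L=12, T=24d. Let Θ# be any transformer parameters with the EUAF emulation property. Then sup_{f∈C([0,1]^p)} inf_{S>0, H^P∈Q_{ℝ^d}(T,L,S)} ‖f̂_{Θ#,H^P,L,p} − f‖_{L^∞([0,1]^p)} ≤ ε, where C([0,1]^p) denotes the continuous real-valued functions on [0,1]^p. -/

import Mathlib

open scoped BigOperators
open Matrix

noncomputable section

namespace PromptTF

/-- The ReLU activation function. -/
def relu (x : ℝ) : ℝ := max x 0

/-- The elementary universal activation function (EUAF). -/
def euaf (x : ℝ) : ℝ :=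
  if 0 ≤ x then |x - 2 * (⌊(x + 1) / 2⌋ : ℝ)| else x / (1 + |x|)

/-- Parameters of one transformer layer (attention heads and a feed-forward net). -/
structure TFLayer (D : ℕ) where
  M : ℕ
  Q : Fin M → Matrix (Fin D) (Fin D) ℝ
  K : Fin M → Matrix (Fin D) (Fin D) ℝ
  V : Fin M → Matrix (Fin D) (Fin D) ℝ
  width : ℕ
  W1 : Matrix (Fin width) (Fin D) ℝ
  W2 : Matrix (Fin D) (Fin width) ℝ

/-- Self-attention layer applied to a list of tokens. -/
def attnOut {D : ℕ} (θ : TFLayer D) (H : List (Fin D → ℝ)) : List (Fin D → ℝ) :=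
  H.map fun h => fun i =>
    h i + ∑ m : Fin θ.M,
      (H.map fun h' =>
        relu (dotProduct ((θ.Q m).mulVec h) ((θ.K m).mulVec h')) * ((θ.V m).mulVec h') i).sum

/-- One transformer layer `FFN ∘ Attn`, with feed-forward activation `act`. -/
def layerMap {D : ℕ} (act : ℝ → ℝ) (θ : TFLayer D) (H : List (Fin D → ℝ)) :
    List (Fin D → ℝ) :=
  (attnOut θ H).map fun h => fun i =>
    h i + (θ.W2.mulVec fun k => act ((θ.W1.mulVec h) k)) i

/-- Multi-layer transformer, all activations ReLU. -/
def tfForward {D : ℕ} (Θ : List (TFLayer D)) (H : List (Fin D → ℝ)) : List (Fin D → ℝ) :=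
  Θ.foldl (fun H' θ => layerMap relu θ H') H

/-- Multi-layer transformer whose first feed-forward layer uses the EUAF activation. -/
def tfForwardEUAF {D : ℕ} (Θ : List (TFLayer D)) (H : List (Fin D → ℝ)) :
    List (Fin D → ℝ) :=
  match Θ with
  | [] => H
  | θ :: rest => rest.foldl (fun H' θ' => layerMap relu θ' H') (layerMap euaf θ H)

/-- Sequential (autoregressive) generation: append the last output column repeatedly. -/
def genTokens {D : ℕ} (forward : List (Fin D → ℝ) → List (Fin D → ℝ))
    (H : List (Fin D → ℝ)) : ℕ → List (Fin D → ℝ)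
  | 0 => H
  | v + 1 =>
      genTokens forward H v ++ [(forward (genTokens forward H v)).getLastD (fun _ => 0)]

/-- The token at one-based position `m` in the generated sequence. -/
def tokenAt {D : ℕ} (forward : List (Fin D → ℝ) → List (Fin D → ℝ))
    (H : List (Fin D → ℝ)) (m : ℕ) : Fin D → ℝ :=
  (genTokens forward H (m - H.length)).getD (m - 1) (fun _ => 0)

/-- A token with word embedding `u`, layer index `w`, position `j` and scale `S`:
`(uᵀ, 0_{3d+4}ᵀ, 1, S, S·w, S·j)ᵀ ∈ ℝ^{4d+8}`. -/
def promptToken (d : ℕ) (u : Fin d → ℝ) (w : ℤ) (j : ℕ) (S : ℝ) : Fin (4 * d + 8) → ℝ :=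
  fun i =>
    if h : (i : ℕ) < d then u ⟨i, h⟩
    else if (i : ℕ) = 4 * d + 4 then 1
    else if (i : ℕ) = 4 * d + 5 then S
    else if (i : ℕ) = 4 * d + 6 then S * w
    else if (i : ℕ) = 4 * d + 7 then S * j
    else 0

/-- First `d` coordinates of a token. -/
def firstd (d : ℕ) (h : Fin (4 * d + 8) → ℝ) : Fin d → ℝ :=
  fun k => h (Fin.castLE (by omega) k)

/-- Initial input: `T` prompt tokens followed by `N` data tokens. -/
def initialInput (d T N : ℕ) (u : Fin T → Fin d → ℝ) (w : Fin T → ℕ) (S : ℝ)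
    (z : Fin N → Fin d → ℝ) : List (Fin (4 * d + 8) → ℝ) :=
  ((List.finRange T).map fun j => promptToken d (u j) (w j) ((j : ℕ) + 1) S)
    ++ ((List.finRange N).map fun i => promptToken d (z i) 0 (T + (i : ℕ) + 1) S)

/-- The closed Euclidean ball of radius `B` in `ℝ^d`. -/
def eball (d : ℕ) (B : ℝ) : Set (Fin d → ℝ) :=
  {v | Real.sqrt (∑ k, v k ^ 2) ≤ B}

/-- Data of a valid prompt in `P_U(T, L, S)`: word embeddings in `U`,
layer indices in `{1, …, 2L}`. -/
def ValidPrompt {d : ℕ} (U : Set (Fin d → ℝ)) (T L : ℕ)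
    (u : Fin T → Fin d → ℝ) (w : Fin T → ℕ) : Prop :=
  (∀ j, u j ∈ U) ∧ ∀ j, 1 ≤ w j ∧ w j ≤ 2 * L

/-- The virtual weight matrix `W^P_ℓ` (without the first-layer correction term). -/
def WPmat {d T : ℕ} (u : Fin T → Fin d → ℝ) (w : Fin T → ℕ) (ℓ : ℕ) :
    Matrix (Fin d) (Fin d) ℝ :=
  ∑ j : Fin T,
    if h : (j : ℕ) + 1 < T then
      (if w j = 2 * ℓ - 1 ∧ w ⟨(j : ℕ) + 1, h⟩ = 2 * ℓ then
        vecMulVec (u j) (u ⟨(j : ℕ) + 1, h⟩) else 0)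
    else 0

/-- The first-layer correction term `(h_T)_{1:d} 1{w_T=1} Σ_{j'} (h_{j'})_{1:d}ᵀ 1{w_{j'}=1}`. -/
def WPcorr {d T : ℕ} (u : Fin T → Fin d → ℝ) (w : Fin T → ℕ) :
    Matrix (Fin d) (Fin d) ℝ :=
  if hT : 0 < T then
    (if w ⟨T - 1, by omega⟩ = 1 then
      vecMulVec (u ⟨T - 1, by omega⟩) (∑ j : Fin T, if w j = 1 then u j else 0)
    else 0)
  else 0

/-- The virtual first-layer weight matrix `W^P_{1,i}`; `first` indicates `i = 1`. -/
def WPone {d T : ℕ} (u : Fin T → Fin d → ℝ) (w : Fin T → ℕ) (first : Bool) :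
    Matrix (Fin d) (Fin d) ℝ :=
  WPmat u w 1 + if first then WPcorr u w else 0

/-- The family of virtual weight matrices of a prompt, for the data token with
zero-based index `i`. -/
def WPfam {d T : ℕ} (u : Fin T → Fin d → ℝ) (w : Fin T → ℕ) (i : ℕ) :
    ℕ → Matrix (Fin d) (Fin d) ℝ :=
  fun ℓ => if ℓ = 1 then WPone u w (i == 0) else WPmat u w ℓ

/-- Output of the virtual network after `ℓ` layers:
`vnetOut … ℓ = W_ℓ act(W_{ℓ-1} act( ⋯ act(W_1 z) ⋯ ))`. -/
def vnetOut (d : ℕ) (act : ℝ → ℝ) (Ws : ℕ → Matrix (Fin d) (Fin d) ℝ)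
    (z : Fin d → ℝ) : ℕ → Fin d → ℝ
  | 0 => z
  | ℓ + 1 =>
      (Ws (ℓ + 1)).mulVec fun k =>
        if ℓ = 0 then vnetOut d act Ws z ℓ k else act (vnetOut d act Ws z ℓ k)

/-- The emulation property: for every admissible prompt and data tokens, the sequentially
generated tokens realize the virtual neural network encoded by the prompt
(with activation `act`). -/
def EmulatesWith (d : ℕ)
    (forward : List (Fin (4 * d + 8) → ℝ) → List (Fin (4 * d + 8) → ℝ))
    (act : ℝ → ℝ) : Prop :=
  ∀ B : ℝ, 1 ≤ B → ∀ T L : ℕ, 0 < T → 0 < L →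
  ∀ U : Set (Fin d → ℝ), U ⊆ eball d B →
  ∀ S : ℝ, max ((d : ℝ) * B ^ (4 * L) * (T : ℝ) ^ (2 * L)) (2 * (L : ℝ)) ≤ S →
  ∀ (u : Fin T → Fin d → ℝ) (w : Fin T → ℕ), ValidPrompt U T L u w →
  ∀ N : ℕ, 0 < N → ∀ z : Fin N → Fin d → ℝ, (∀ i k, z i k ∈ Set.Icc (0 : ℝ) 1) →
  ∀ (i : Fin N) (ℓ : ℕ), 1 ≤ ℓ → ℓ ≤ L →
    tokenAt forward (initialInput d T N u w S z) (T + N * ℓ + (i : ℕ) + 1)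
      = promptToken d (vnetOut d act (WPfam u w (i : ℕ)) (z i) ℓ) (-(ℓ : ℤ))
          (T + N * ℓ + (i : ℕ) + 1) S

/-- The embedding `x ↦ (xᵀ, 1, 0_{d-p-1}ᵀ)ᵀ ∈ ℝ^d` of an input `x ∈ ℝ^p`. -/
def embed (d p : ℕ) (x : Fin p → ℝ) : Fin d → ℝ :=
  fun k => if h : (k : ℕ) < p then x ⟨k, h⟩ else if (k : ℕ) = p then 1 else 0

/-- The function approximator `f̂_{Θ,H^P,L,p}`: first coordinate of the token at
position `T+1+L` generated from the prompt followed by the single data token. -/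
def fhat {d : ℕ} (forward : List (Fin (4 * d + 8) → ℝ) → List (Fin (4 * d + 8) → ℝ))
    {T : ℕ} (u : Fin T → Fin d → ℝ) (w : Fin T → ℕ) (S : ℝ) (L p : ℕ)
    (x : Fin p → ℝ) : ℝ :=
  tokenAt forward (initialInput d T 1 u w S fun _ => embed d p x) (T + 1 + L)
    ⟨0, by omega⟩

/-- The unit cube `[0,1]^p`. -/
def unitCube (p : ℕ) : Set (Fin p → ℝ) := Set.Icc 0 1

/-- The sup-distance `‖f - g‖_{L^∞([0,1]^p)}`. -/
def supDist (p : ℕ) (f g : (Fin p → ℝ) → ℝ) : ℝ :=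
  ⨆ x : unitCube p, |f x.1 - g x.1|

/-- Partial derivative (within the unit cube) in coordinate direction `i`. -/
def pderivW (p : ℕ) (i : Fin p) (f : (Fin p → ℝ) → ℝ) : (Fin p → ℝ) → ℝ :=
  fun x => fderivWithin ℝ f (unitCube p) x (Pi.single i 1)

/-- Iterated partial derivative along a list of coordinate directions. -/
def pderivList (p : ℕ) : List (Fin p) → ((Fin p → ℝ) → ℝ) → (Fin p → ℝ) → ℝ
  | [], f => f
  | i :: is, f => pderivList p is (pderivW p i f)

/-- The unit ball `C_u^β([0,1]^p)` of `β`-times continuously differentiable functions with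
all partial derivatives of order `≤ β` bounded by `1` on the cube. -/
def Hclass (p β : ℕ) : Set ((Fin p → ℝ) → ℝ) :=
  {f | ContDiffOn ℝ β f (unitCube p) ∧
    ∀ ls : List (Fin p), ls.length ≤ β →
      ∀ x ∈ unitCube p, |pderivList p ls f x| ≤ 1}

/-- `U_{d,r}` : the span of the first `r` standard basis vectors of `ℝ^d`. -/
def spanFirst (d r : ℕ) : Set (Fin d → ℝ) :=
  {v | ∀ k : Fin d, r ≤ (k : ℕ) → v k = 0}

/-- Hidden layers of a standard ReLU network of width `r` (with biases). -/
def nnHidden {p r : ℕ} (W0 : Matrix (Fin r) (Fin p) ℝ) (b0 : Fin r → ℝ)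
    (Wm : ℕ → Matrix (Fin r) (Fin r) ℝ) (bm : ℕ → Fin r → ℝ) (x : Fin p → ℝ) :
    ℕ → Fin r → ℝ
  | 0 => fun i => W0.mulVec x i + b0 i
  | k + 1 => fun i =>
      (Wm k).mulVec (fun j => relu (nnHidden W0 b0 Wm bm x k j)) i + bm k i

/-- The class `N(r,p,L)` of ReLU networks `ℝ^p → ℝ` of width `r` and depth `L`
(`L` affine maps with ReLU in between). -/
def NNclass (r p L : ℕ) : Set ((Fin p → ℝ) → ℝ) :=
  {f | if L = 1 then ∃ (a : Fin p → ℝ) (b : ℝ), f = fun x => (∑ i, a i * x i) + b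
    else ∃ (W0 : Matrix (Fin r) (Fin p) ℝ) (b0 : Fin r → ℝ)
      (Wm : ℕ → Matrix (Fin r) (Fin r) ℝ) (bm : ℕ → Fin r → ℝ)
      (wL : Fin r → ℝ) (bL : ℝ),
      f = fun x => (∑ j, wL j * relu (nnHidden W0 b0 Wm bm x (L - 2) j)) + bL}

/-- Operator norm (w.r.t. the Euclidean norm) of a `d × d` matrix. -/
def opNorm {d : ℕ} (W : Matrix (Fin d) (Fin d) ℝ) : ℝ :=
  ‖LinearMap.toContinuousLinearMap (Matrix.toEuclideanLin W)‖

/-- The class `W(r,d,U,B)` of coarse weight matrices. -/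
def coarseW (d r : ℕ) (U : Set (Fin d → ℝ)) (B : ℝ) :
    Set (Matrix (Fin d) (Fin d) ℝ) :=
  {W | (∃ ut uu : Fin r → Fin d → ℝ,
        (∀ k, ut k ∈ U) ∧ (∀ k, uu k ∈ U) ∧ W = ∑ k, vecMulVec (ut k) (uu k)) ∧
    opNorm W ≤ B ^ 2}

open Classical in
/-- Number of nonzero parameter entries of one transformer layer. -/
def layerNonzero {D : ℕ} (θ : TFLayer D) : ℕ :=
  (Finset.univ.filter fun p : Fin θ.M × Fin D × Fin D => θ.Q p.1 p.2.1 p.2.2 ≠ 0).card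
  + (Finset.univ.filter fun p : Fin θ.M × Fin D × Fin D => θ.K p.1 p.2.1 p.2.2 ≠ 0).card
  + (Finset.univ.filter fun p : Fin θ.M × Fin D × Fin D => θ.V p.1 p.2.1 p.2.2 ≠ 0).card
  + (Finset.univ.filter fun p : Fin θ.width × Fin D => θ.W1 p.1 p.2 ≠ 0).card
  + (Finset.univ.filter fun p : Fin D × Fin θ.width => θ.W2 p.1 p.2 ≠ 0).card

/-- Total number of nonzero parameter entries of a transformer. -/
def tfNonzero {D : ℕ} (Θ : List (TFLayer D)) : ℕ := (Θ.map layerNonzero).sum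

/-- All parameter entries of one layer bounded in absolute value by `c`. -/
def layerEntriesBounded {D : ℕ} (θ : TFLayer D) (c : ℝ) : Prop :=
  (∀ m i j, |θ.Q m i j| ≤ c) ∧ (∀ m i j, |θ.K m i j| ≤ c) ∧ (∀ m i j, |θ.V m i j| ≤ c)
  ∧ (∀ i j, |θ.W1 i j| ≤ c) ∧ ∀ i j, |θ.W2 i j| ≤ c

end PromptTF
end

open PromptTF Matrix

namespace PromptTF

/-! ### The activation function -/

theorem euaf_of_nonneg {x : ℝ} (hx : 0 ≤ x) : euaf x = |x - 2 * (⌊(x + 1) / 2⌋ : ℝ)| := by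
  simp [euaf, hx]

theorem euaf_neg {t : ℝ} (ht : 0 ≤ t) : euaf (-t) = 1 / (1 + t) - 1 := by
  rcases ht.eq_or_lt with rfl | ht
  · norm_num [euaf]
  · have h : ¬ (0 ≤ -t) := by linarith
    rw [euaf, if_neg h, abs_neg, abs_of_pos ht]
    field_simp
    ring

theorem abs_euaf_le_one (x : ℝ) : |euaf x| ≤ 1 := by
  rcases le_or_gt 0 x with hx | hx
  · rw [euaf_of_nonneg hx, abs_abs, abs_le]
    constructor <;> linarith [Int.floor_le ((x + 1) / 2), Int.lt_floor_add_one ((x + 1) / 2)]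
  · obtain ⟨t, rfl⟩ : ∃ t, x = -t := ⟨-x, by ring⟩
    have ht : 0 < 1 + t := by linarith
    rw [euaf_neg (by linarith), abs_le]
    have h0 : 0 ≤ 1 / (1 + t) := by positivity
    have h1 : 1 / (1 + t) ≤ 1 := by rw [div_le_one ht]; linarith
    constructor <;> linarith

theorem euaf_nonneg {x : ℝ} (hx : 0 ≤ x) : 0 ≤ euaf x := by
  rw [euaf_of_nonneg hx]
  exact abs_nonneg _

/-- On the positive half line the activation is `2`-periodic, `1`-Lipschitz, and equal to the
identity on `[0, 1]`. -/
theorem abs_euaf_sub_le {x y : ℝ} (k : ℤ) (hx : 0 ≤ x) (hy0 : 0 ≤ y) (hy1 : y ≤ 1) :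
    |euaf x - y| ≤ |x - y - 2 * k| := by
  rw [euaf_of_nonneg hx]
  have h1 := Int.floor_le ((x + 1) / 2)
  have h2 := Int.lt_floor_add_one ((x + 1) / 2)
  set n := ⌊(x + 1) / 2⌋
  rcases lt_trichotomy n k with h | h | h
  · have : (n : ℝ) + 1 ≤ k := by exact_mod_cast h
    rw [abs_le, abs_of_nonpos (by linarith : x - y - 2 * k ≤ 0)]
    rcases abs_cases (x - 2 * (n : ℝ)) with ⟨e, he⟩ | ⟨e, he⟩ <;> rw [e] <;>
      constructor <;> linarith
  · subst h
    rcases abs_cases (x - 2 * (n : ℝ)) with ⟨e, he⟩ | ⟨e, he⟩ <;>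
    rcases abs_cases (x - y - 2 * (n : ℝ)) with ⟨e', he'⟩ | ⟨e', he'⟩ <;> rw [e, e'] <;>
      rw [abs_le] <;> constructor <;> linarith
  · have : (k : ℝ) + 1 ≤ n := by exact_mod_cast h
    rw [abs_le, abs_of_nonneg (by linarith : 0 ≤ x - y - 2 * k)]
    rcases abs_cases (x - 2 * (n : ℝ)) with ⟨e, he⟩ | ⟨e, he⟩ <;> rw [e] <;>
      constructor <;> linarith

theorem euaf_eq {x y : ℝ} (k : ℤ) (hx : 0 ≤ x) (hy0 : 0 ≤ y) (hy1 : y ≤ 1)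
    (h : x = y + 2 * k) : euaf x = y := by
  have := abs_euaf_sub_le k hx hy0 hy1
  rw [h, show y + 2 * (k : ℝ) - y - 2 * k = 0 by ring, abs_zero, ← h] at this
  exact sub_eq_zero.1 (abs_nonpos_iff.1 this)

theorem euaf_of_mem_Icc {x : ℝ} (h0 : 0 ≤ x) (h1 : x ≤ 1) : euaf x = x :=
  euaf_eq 0 h0 h0 h1 (by simp)

theorem euaf_eq_neg {x y : ℝ} (k : ℤ) (hx : 0 ≤ x) (hy0 : 0 ≤ y) (hy1 : y ≤ 1)
    (h : x = -y + 2 * k) : euaf x = y := by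
  rcases hy1.eq_or_lt with rfl | hy1
  · exact euaf_eq (k - 1) hx zero_le_one le_rfl (by rw [h]; push_cast; ring)
  · have hn : ⌊(x + 1) / 2⌋ = k := by
      rw [Int.floor_eq_iff]
      constructor <;> linarith
    rw [euaf_of_nonneg hx, hn, h, add_sub_cancel_right, abs_neg, abs_of_nonneg hy0]

theorem euaf_add_one {y : ℝ} (hy : |y| ≤ 1) : euaf (y + 1) = 1 - |y| := by
  have h := abs_le.1 hy
  rcases abs_cases y with ⟨e, h'⟩ | ⟨e, h'⟩ <;> rw [e]
  · exact euaf_eq_neg 1 (by linarith) (by linarith) (by linarith) (by push_cast; ring)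
  · exact euaf_eq 0 (by linarith) (by linarith) (by linarith) (by push_cast; ring)

/-- Two triangle waves in quadrature locate a point inside its unit cell. -/
theorem euaf_cell (n : ℕ) {r : ℝ} (h0 : 0 ≤ r) (h1 : r ≤ 1) :
    (euaf (n + r) = r ∧ euaf (n + r + 1 / 2) = 1 / 2 + min r (1 - r)) ∨
      (euaf (n + r) = 1 - r ∧ euaf (n + r + 1 / 2) = 1 / 2 - min r (1 - r)) := by
  have hn : (0 : ℝ) ≤ n := n.cast_nonneg
  obtain ⟨k, rfl | rfl⟩ := n.even_or_odd'
  · left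
    refine ⟨euaf_eq k (by linarith) h0 h1 (by push_cast; ring), ?_⟩
    rcases le_total r (1 - r) with h | h
    · rw [min_eq_left h]
      exact euaf_eq k (by linarith) (by linarith) (by linarith) (by push_cast; ring)
    · rw [min_eq_right h]
      exact euaf_eq_neg (k + 1) (by linarith) (by linarith) (by linarith) (by push_cast; ring)
  · right
    refine ⟨euaf_eq_neg (k + 1) (by linarith) (by linarith) (by linarith)
      (by push_cast; ring), ?_⟩
    rcases le_total r (1 - r) with h | h
    · rw [min_eq_left h]
      exact euaf_eq_neg (k + 1) (by linarith) (by linarith) (by linarith) (by push_cast; ring)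
    · rw [min_eq_right h]
      exact euaf_eq (k + 1) (by linarith) (by linarith) (by linarith) (by push_cast; ring)

/-! ### Fitting finitely many values with two parameters -/

theorem exists_pow_mul_approx (a : ℕ) (ha : 0 < a) (N : ℕ) (τ : ℕ → ℝ) :
    ∃ s : ℝ, ∀ i < N, ∃ k : ℤ, |(a : ℝ) ^ i * s - τ i - 2 * k| ≤ 1 / a := by
  have ha' : (0 : ℝ) < a := by exact_mod_cast ha
  induction N generalizing τ with
  | zero => exact ⟨0, by simp⟩
  | succ N ih =>
    obtain ⟨s, hs⟩ := ih fun i => τ (i + 1)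
    let k := round ((a * τ 0 - s) / 2)
    have hk : |(a * τ 0 - s) / 2 - k| ≤ 1 / 2 := abs_sub_round _
    refine ⟨(s + 2 * k) / a, fun i hi => ?_⟩
    cases i with
    | zero =>
      refine ⟨0, ?_⟩
      have : (a : ℝ) ^ 0 * ((s + 2 * k) / a) - τ 0 - 2 * ((0 : ℤ) : ℝ)
          = -(2 * ((a * τ 0 - s) / 2 - k)) / a := by
        push_cast
        field_simp
        ring
      rw [this, abs_div, abs_neg, abs_mul, abs_of_pos ha', abs_two]
      gcongr
      linarith
    | succ i =>
      obtain ⟨m, hm⟩ := hs i (by omega)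
      refine ⟨m + a ^ i * k, ?_⟩
      convert hm using 2
      push_cast
      field_simp
      ring

theorem exists_euaf_fit (N : ℕ) (y : ℕ → ℝ) (hy : ∀ n < N, 0 ≤ y n ∧ y n ≤ 1)
    {ε : ℝ} (hε : 0 < ε) :
    ∃ a w : ℝ, 1 ≤ a ∧ 0 ≤ w ∧ ∀ n < N, |euaf (w * (1 / (a + n))) - y n| ≤ ε := by
  classical
  let P : Polynomial ℝ := Lagrange.interpolate (Finset.range N) (fun n : ℕ => (n : ℝ)) y
  have hinj : Set.InjOn (fun n : ℕ => (n : ℝ)) (Finset.range N) := fun a _ b _ h => Nat.cast_injective h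
  have hdeg : ∀ n < N, ∑ j ∈ Finset.range N, P.coeff j * (n : ℝ) ^ j = y n := by
    intro n hn
    rw [← Polynomial.eval_eq_sum_range' (n := N) (p := P)]
    · exact Lagrange.eval_interpolate_at_node y hinj (by simpa using hn)
    · have h := Lagrange.degree_interpolate_lt y hinj
      rw [Finset.card_range] at h
      by_cases h0 : P = 0
      · simp only [h0, Polynomial.natDegree_zero]; omega
      · exact (Polynomial.natDegree_lt_iff_degree_lt h0).2 h
  let C : ℝ := ∑ j ∈ Finset.range N, (N : ℝ) ^ j + 2 * (N : ℝ) ^ N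
  have hC : 0 ≤ C := by positivity
  obtain ⟨a, ha⟩ := exists_nat_gt (max 1 (C / ε))
  have ha1 : (1 : ℝ) < a := lt_of_le_of_lt (le_max_left _ _) ha
  have haC : C / ε < a := lt_of_le_of_lt (le_max_right _ _) ha
  have ha0 : (0 : ℝ) < a := by linarith
  obtain ⟨s₀, hs₀⟩ := exists_pow_mul_approx a (by exact_mod_cast ha0) N
    fun i => (-1) ^ (N - 1 - i) * P.coeff (N - 1 - i)
  let s := 2 * Int.fract (s₀ / 2)
  have hs0 : 0 ≤ s := by have := Int.fract_nonneg (s₀ / 2); simp only [s]; linarith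
  have hs2 : s ≤ 2 := by have := (Int.fract_lt_one (s₀ / 2)).le; simp only [s]; linarith
  have hs : ∀ j < N, ∃ k : ℤ,
      |(a : ℝ) ^ (N - 1 - j) * s - (-1) ^ j * P.coeff j - 2 * k| ≤ 1 / a := by
    intro j hj
    obtain ⟨k, hk⟩ := hs₀ (N - 1 - j) (by omega)
    rw [show N - 1 - (N - 1 - j) = j by omega] at hk
    refine ⟨k - a ^ (N - 1 - j) * ⌊s₀ / 2⌋, ?_⟩
    convert hk using 2
    simp only [s, Int.fract]
    push_cast
    ring
  choose! k hk using hs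
  refine ⟨a, a ^ N * s, ha1.le, by positivity, fun n hn => ?_⟩
  have hn0 : (0 : ℝ) ≤ n := n.cast_nonneg
  have hnN : (n : ℝ) ≤ N := by exact_mod_cast hn.le
  have han : (0 : ℝ) < a + n := by linarith
  refine (abs_euaf_sub_le (∑ j ∈ Finset.range N, (-n : ℤ) ^ j * k j) (by positivity)
    (hy n hn).1 (hy n hn).2).trans ?_
  have hgeom : (a : ℝ) ^ N * s * (1 / (a + n)) =
      ∑ j ∈ Finset.range N, (-(n : ℝ)) ^ j * ((a : ℝ) ^ (N - 1 - j) * s)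
        + s * (-(n : ℝ)) ^ N / (a + n) := by
    have h := geom_sum₂_mul (-(n : ℝ)) (a : ℝ) N
    have h' : ∑ j ∈ Finset.range N, (-(n : ℝ)) ^ j * ((a : ℝ) ^ (N - 1 - j) * s)
        = s * ∑ j ∈ Finset.range N, (-(n : ℝ)) ^ j * (a : ℝ) ^ (N - 1 - j) := by
      rw [Finset.mul_sum]
      exact Finset.sum_congr rfl fun j _ => by ring
    rw [h']
    field_simp
    linear_combination s * h
  have hsum : (a : ℝ) ^ N * s * (1 / (a + n)) - y n
        - 2 * ((∑ j ∈ Finset.range N, (-n : ℤ) ^ j * k j : ℤ) : ℝ)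
      = ∑ j ∈ Finset.range N, (-(n : ℝ)) ^ j *
          ((a : ℝ) ^ (N - 1 - j) * s - (-1) ^ j * P.coeff j - 2 * k j)
        + s * (-(n : ℝ)) ^ N / (a + n) := by
    rw [hgeom, ← hdeg n hn]
    push_cast
    rw [Finset.mul_sum, add_sub_right_comm, add_sub_right_comm, ← Finset.sum_sub_distrib,
      ← Finset.sum_sub_distrib]
    congr 1
    refine Finset.sum_congr rfl fun j _ => ?_
    have : (-(n : ℝ)) ^ j * (-1) ^ j = (n : ℝ) ^ j := by rw [← mul_pow]; simp
    linear_combination P.coeff j * this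
  rw [hsum]
  have hle : C / a ≤ ε := by
    rw [div_lt_iff₀ hε] at haC
    rw [div_le_iff₀ ha0]
    linarith
  refine le_trans ?_ hle
  simp only [C]
  rw [add_div, Finset.sum_div]
  refine (abs_add_le _ _).trans (add_le_add ((Finset.abs_sum_le_sum_abs _ _).trans ?_) ?_)
  · refine Finset.sum_le_sum fun j hj => ?_
    rw [abs_mul, abs_pow, abs_neg, abs_of_nonneg hn0, div_eq_mul_one_div ((N : ℝ) ^ j)]
    gcongr
    exact hk j (Finset.mem_range.1 hj)
  · rw [abs_div, abs_mul, abs_pow, abs_neg, abs_of_nonneg hn0, abs_of_nonneg hs0,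
      abs_of_pos han]
    gcongr
    linarith

/-! ### Approximate multiplication -/

/-- A combination of two reciprocals approximating `y ^ 2`. -/
noncomputable def approxSq (A y : ℝ) : ℝ := A ^ 3 / 2 * (1 / (A - y) + 1 / (A + y)) - A ^ 2

theorem abs_approxSq_sub_le {A y : ℝ} (hA : 4 ≤ A) (hy : |y| ≤ 2) :
    |approxSq A y - y ^ 2| ≤ 32 / A ^ 2 := by
  have h := abs_le.1 hy
  have h1 : 0 < A - y := by linarith
  have h2 : 0 < A + y := by linarith
  have hyy : y ^ 2 ≤ 4 := by nlinarith
  have hA2 : 16 ≤ A ^ 2 := by nlinarith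
  have h3 : 0 < A ^ 2 - y ^ 2 := by linarith
  have e : approxSq A y - y ^ 2 = y ^ 4 / (A ^ 2 - y ^ 2) := by
    have : A ^ 2 - y ^ 2 = (A - y) * (A + y) := by ring
    rw [approxSq, this]
    field_simp
    ring
  rw [e, abs_of_nonneg (by positivity), div_le_div_iff₀ h3 (by positivity)]
  have : y ^ 4 ≤ 16 := by nlinarith [sq_nonneg y]
  nlinarith

theorem exists_approxMul {ε : ℝ} (hε : 0 < ε) :
    ∃ A : ℝ, 4 ≤ A ∧ ∀ a b : ℝ, 0 ≤ a → a ≤ 1 → 0 ≤ b → b ≤ 1 →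
      |(approxSq A (a + b) - approxSq A (a - b)) / 4 - a * b| ≤ ε := by
  refine ⟨4 + 16 / ε, by have : 0 < 16 / ε := by positivity
                         linarith, fun a b ha0 ha1 hb0 hb1 => ?_⟩
  set A := 4 + 16 / ε with hA
  have hA4 : 4 ≤ A := by have : 0 < 16 / ε := by positivity
                         linarith
  have h1 := abs_le.1 (abs_approxSq_sub_le hA4 (y := a + b) (abs_le.2 ⟨by linarith, by linarith⟩))
  have h2 := abs_le.1 (abs_approxSq_sub_le hA4 (y := a - b) (abs_le.2 ⟨by linarith, by linarith⟩))
  have h3 : 16 / A ^ 2 ≤ ε := by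
    rw [div_le_iff₀ (by positivity)]
    have : ε * A = 4 * ε + 16 := by rw [hA]; field_simp
    nlinarith
  have h4 : 32 / A ^ 2 = 2 * (16 / A ^ 2) := by ring
  rw [abs_le]
  constructor <;> nlinarith

/-! ### Prompts encode arbitrary weight matrices -/

theorem vnetOut_congr {d : ℕ} (act : ℝ → ℝ) {Ws Ws' : ℕ → Matrix (Fin d) (Fin d) ℝ}
    (z : Fin d → ℝ) {k : ℕ} (h : ∀ ℓ, 1 ≤ ℓ → ℓ ≤ k → Ws ℓ = Ws' ℓ) :
    vnetOut d act Ws z k = vnetOut d act Ws' z k := by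
  induction k with
  | zero => rfl
  | succ k ih =>
    rw [vnetOut, vnetOut, h (k + 1) (by omega) le_rfl, ih fun ℓ h1 h2 => h ℓ h1 (by omega)]

theorem exists_prompt {d : ℕ} (hd : 0 < d) (Ws : ℕ → Matrix (Fin d) (Fin d) ℝ) :
    ∃ (u : Fin (24 * d) → Fin d → ℝ) (w : Fin (24 * d) → ℕ),
      ValidPrompt Set.univ (24 * d) 12 u w ∧
        ∀ ℓ, 1 ≤ ℓ → ℓ ≤ 12 → WPfam u w 0 ℓ = Ws ℓ := by
  have hidx : ∀ j : ℕ, j % (2 * d) / 2 < d := fun j => by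
    have := Nat.mod_lt j (show 0 < 2 * d by omega)
    omega
  have hlay : ∀ j : Fin (24 * d), (j : ℕ) / (2 * d) < 12 := fun j => by
    rw [Nat.div_lt_iff_lt_mul (by omega)]
    omega
  have hpar : ∀ j : ℕ, j % (2 * d) % 2 = j % 2 := fun j =>
    Nat.mod_mod_of_dvd j ⟨d, rfl⟩
  let u : Fin (24 * d) → Fin d → ℝ := fun j =>
    if (j : ℕ) % 2 = 0 then Pi.single ⟨(j : ℕ) % (2 * d) / 2, hidx j⟩ 1
    else Ws ((j : ℕ) / (2 * d) + 1) ⟨(j : ℕ) % (2 * d) / 2, hidx j⟩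
  let w : Fin (24 * d) → ℕ := fun j => 2 * ((j : ℕ) / (2 * d)) + 1 + (j : ℕ) % 2
  have hmat : ∀ ℓ, 1 ≤ ℓ → ℓ ≤ 12 → WPmat u w ℓ = Ws ℓ := by
    intro ℓ h1 h12
    obtain ⟨m, rfl⟩ : ∃ m, ℓ = m + 1 := ⟨ℓ - 1, by omega⟩
    ext r c
    have hr := r.isLt
    have hb : 2 * d * m + 2 * (r : ℕ) + 1 < 24 * d := by
      have : d * m ≤ d * 11 := Nat.mul_le_mul_left d (by omega)
      have e : 2 * d * m = 2 * (d * m) := by ring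
      omega
    have hdiv : ∀ b < 2, (2 * d * m + 2 * (r : ℕ) + b) / (2 * d) = m := fun b hb => by
      rw [add_assoc, Nat.mul_add_div (by omega), Nat.div_eq_of_lt (by omega), add_zero]
    have hmod : ∀ b < 2, (2 * d * m + 2 * (r : ℕ) + b) % (2 * d) = 2 * r + b := fun b hb => by
      rw [add_assoc, Nat.mul_add_mod, Nat.mod_eq_of_lt (by omega)]
    have hpar' : ∀ b < 2, (2 * d * m + 2 * (r : ℕ) + b) % 2 = b := fun b hb => by
      rw [← hpar, hmod b hb]
      omega
    have hdiv0 := hdiv 0 (by omega)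
    have hdiv1 := hdiv 1 (by omega)
    have hmod0 := hmod 0 (by omega)
    have hmod1 := hmod 1 (by omega)
    have hpar0 := hpar' 0 (by omega)
    have hpar1 := hpar' 1 (by omega)
    simp only [add_zero] at hdiv0 hmod0 hpar0
    rw [WPmat, Matrix.sum_apply, Finset.sum_eq_single ⟨2 * d * m + 2 * r, by omega⟩]
    · have e0 : 2 * (r : ℕ) / 2 = r := by omega
      have e1 : (2 * (r : ℕ) + 1) / 2 = r := by omega
      have c1 : 2 * m + 1 = 2 * (m + 1) - 1 := by omega
      have c2 : 2 * m + 1 + 1 = 2 * (m + 1) := by omega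
      rw [dif_pos hb, if_pos ⟨by simp only [w, hdiv0, hpar0]; omega,
        by simp only [w, hdiv1, hpar1]; omega⟩, vecMulVec_apply]
      simp only [u, hpar0, hpar1, hdiv1, hmod0, hmod1, e0, e1, if_true, one_ne_zero, if_false,
        Fin.eta, Pi.single_eq_same, one_mul]
    · intro j _ hj
      split_ifs with h h'
      · obtain ⟨h', -⟩ := h'
        have hp : (j : ℕ) % 2 = 0 := by simp only [w] at h'; omega
        have hl : (j : ℕ) / (2 * d) = m := by simp only [w] at h'; omega
        have hne : r ≠ ⟨(j : ℕ) % (2 * d) / 2, hidx j⟩ := by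
          intro hrj
          apply hj
          have e1 := congrArg Fin.val hrj
          have e2 := Nat.div_add_mod (j : ℕ) (2 * d)
          have e3 := hpar j
          rw [hl] at e2
          simp only at e1
          apply Fin.ext
          simp only
          omega
        rw [vecMulVec_apply]
        simp only [u, hp, if_true]
        rw [Pi.single_eq_of_ne hne, zero_mul]
      · rfl
      · rfl
    · intro h
      exact absurd (Finset.mem_univ _) h
  have hcorr : WPcorr u w = 0 := by
    have hodd : (24 * d - 1) % 2 = 1 := by omega
    rw [WPcorr, dif_pos (by omega), if_neg]
    simp only [w, hodd]
    omega
  refine ⟨u, w, ⟨fun _ => Set.mem_univ _, fun j => ?_⟩, fun ℓ h1 h12 => ?_⟩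
  · have := hlay j
    simp only [w]
    omega
  · rw [WPfam]
    split_ifs with h
    · subst h
      simp only [WPone, hcorr, ite_self, add_zero, hmat 1 le_rfl (by omega)]
    · exact hmat ℓ h1 h12

theorem exists_eball_subset {d T : ℕ} (u : Fin T → Fin d → ℝ) :
    ∃ B : ℝ, 1 ≤ B ∧ Set.range u ⊆ eball d B := by
  refine ⟨1 + ∑ j, Real.sqrt (∑ k, u j k ^ 2), ?_, ?_⟩
  · have : 0 ≤ ∑ j, Real.sqrt (∑ k, u j k ^ 2) := Finset.sum_nonneg fun j _ => Real.sqrt_nonneg _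
    linarith
  · rintro _ ⟨j, rfl⟩
    have := Finset.single_le_sum (f := fun j => Real.sqrt (∑ k, u j k ^ 2))
      (fun j _ => Real.sqrt_nonneg _) (Finset.mem_univ j)
    simp only [eball, Set.mem_ofPred_eq]
    linarith

theorem exists_fhat_eq {d p : ℕ} (hd : 0 < d)
    {forward : List (Fin (4 * d + 8) → ℝ) → List (Fin (4 * d + 8) → ℝ)} {act : ℝ → ℝ}
    (hforward : EmulatesWith d forward act) (Ws : ℕ → Matrix (Fin d) (Fin d) ℝ) :
    ∃ (S : ℝ) (u : Fin (24 * d) → Fin d → ℝ) (w : Fin (24 * d) → ℕ),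
      0 < S ∧ ValidPrompt Set.univ (24 * d) 12 u w ∧
        ∀ x ∈ unitCube p,
          fhat forward u w S 12 p x = vnetOut d act Ws (embed d p x) 12 ⟨0, hd⟩ := by
  obtain ⟨u, w, hv, hW⟩ := exists_prompt hd Ws
  obtain ⟨B, hB1, hB⟩ := exists_eball_subset u
  let S : ℝ := max ((d : ℝ) * B ^ (4 * 12) * ((24 * d : ℕ) : ℝ) ^ (2 * 12)) (2 * ((12 : ℕ) : ℝ))
  refine ⟨S, u, w, lt_of_lt_of_le (by norm_num) (le_max_right _ _), hv, fun x hx => ?_⟩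
  have hz : ∀ (i : Fin 1) (k : Fin d),
      (fun _ : Fin 1 => embed d p x) i k ∈ Set.Icc (0 : ℝ) 1 := by
    intro _ k
    simp only [embed]
    split_ifs with h
    · exact ⟨hx.1 _, hx.2 _⟩
    · simp
    · simp
  have h := hforward B hB1 (24 * d) 12 (by omega) (by omega) (Set.range u) hB S le_rfl u w
    ⟨fun j => Set.mem_range_self j, hv.2⟩ 1 one_pos (fun _ => embed d p x) hz 0 12
    (by omega) le_rfl
  have e : 24 * d + 1 * 12 + ((0 : Fin 1) : ℕ) + 1 = 24 * d + 1 + 12 := by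
    simp only [Fin.val_zero]
  rw [e] at h
  rw [fhat, h, promptToken, dif_pos hd]
  exact congrFun (vnetOut_congr act _ hW) _

/-! ### Functions computed by the virtual network -/

/-- `Reach d p k V`: every function in `V` is a linear combination of the neurons in the `k`-th
hidden layer of a single width-`d` network on the unit cube (the input coordinates for `k = 0`). -/
def Reach (d p : ℕ) : ℕ → Submodule ℝ (unitCube p → ℝ) → Prop
  | 0, V => V ≤ Submodule.span ℝ (Set.range fun (i : Fin d) (x : unitCube p) => embed d p x.1 i)
  | k + 1, V => ∃ V', Reach d p k V' ∧ ∃ F : Fin d → unitCube p → ℝ,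
      (∀ i, ∃ g ∈ V', F i = fun x => euaf (g x)) ∧ V ≤ Submodule.span ℝ (Set.range F)

theorem Reach.exists_vnetOut {d p : ℕ} {k : ℕ} {V : Submodule ℝ (unitCube p → ℝ)}
    (h : Reach d p k V) : ∃ Ws : ℕ → Matrix (Fin d) (Fin d) ℝ, ∀ g ∈ V, ∃ c : Fin d → ℝ,
      ∀ x : unitCube p, g x = ∑ i, c i * (if k = 0 then vnetOut d euaf Ws (embed d p x.1) k i
        else euaf (vnetOut d euaf Ws (embed d p x.1) k i)) := by
  have key : ∀ (F : Fin d → unitCube p → ℝ), ∀ g ∈ Submodule.span ℝ (Set.range F),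
      ∃ c : Fin d → ℝ, ∀ x, g x = ∑ i, c i * F i x := by
    intro F g hg
    obtain ⟨c, rfl⟩ := (Submodule.mem_span_range_iff_exists_fun ℝ).1 hg
    exact ⟨c, fun x => by simp⟩
  induction k generalizing V with
  | zero =>
    refine ⟨0, fun g hg => ?_⟩
    obtain ⟨c, hc⟩ := key _ g (h hg)
    exact ⟨c, by simpa [vnetOut] using hc⟩
  | succ k ih =>
    obtain ⟨V', hV', F, hF, hV⟩ := h
    obtain ⟨Ws, hWs⟩ := ih hV'
    choose G hG hFG using hF
    choose C hC using fun i => hWs (G i) (hG i)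
    refine ⟨Function.update Ws (k + 1) (Matrix.of C), fun g hg => ?_⟩
    obtain ⟨c, hc⟩ := key _ g (hV hg)
    refine ⟨c, fun x => ?_⟩
    have hcongr : vnetOut d euaf (Function.update Ws (k + 1) (Matrix.of C)) (embed d p x.1) k
        = vnetOut d euaf Ws (embed d p x.1) k :=
      vnetOut_congr _ _ fun ℓ _ hℓ => Function.update_of_ne (by omega) _ _
    rw [hc]
    refine Finset.sum_congr rfl fun i _ => ?_
    rw [if_neg (by omega), vnetOut, hcongr, Function.update_self, hFG]
    exact congrArg (fun t => c i * euaf t) (hC i x)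

theorem Reach.exists_vnetOut_succ {d p : ℕ} (hd : 0 < d) {k : ℕ}
    {V : Submodule ℝ (unitCube p → ℝ)} (h : Reach d p k V) {g : unitCube p → ℝ} (hg : g ∈ V) :
    ∃ Ws : ℕ → Matrix (Fin d) (Fin d) ℝ,
      ∀ x : unitCube p, vnetOut d euaf Ws (embed d p x.1) (k + 1) ⟨0, hd⟩ = g x := by
  obtain ⟨Ws, hWs⟩ := h.exists_vnetOut
  obtain ⟨c, hc⟩ := hWs g hg
  refine ⟨Function.update Ws (k + 1) (Matrix.of fun _ => c), fun x => ?_⟩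
  have hcongr : vnetOut d euaf (Function.update Ws (k + 1) (Matrix.of fun _ => c)) (embed d p x.1) k
      = vnetOut d euaf Ws (embed d p x.1) k :=
    vnetOut_congr _ _ fun ℓ _ hℓ => Function.update_of_ne (by omega) _ _
  rw [vnetOut, hcongr, Function.update_self]
  exact (hc x).symm

theorem Reach.bounded {d p : ℕ} {k : ℕ} {V : Submodule ℝ (unitCube p → ℝ)}
    (h : Reach d p k V) {g : unitCube p → ℝ} (hg : g ∈ V) : ∃ A, 0 < A ∧ ∀ x, |g x| ≤ A := by
  have key : ∀ (F : Fin d → unitCube p → ℝ), (∀ i x, |F i x| ≤ 1) →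
      g ∈ Submodule.span ℝ (Set.range F) → ∃ A, 0 < A ∧ ∀ x, |g x| ≤ A := by
    intro F hF hg
    obtain ⟨c, rfl⟩ := (Submodule.mem_span_range_iff_exists_fun ℝ).1 hg
    refine ⟨1 + ∑ i, |c i|, by positivity, fun x => ?_⟩
    simp only [Finset.sum_apply, Pi.smul_apply, smul_eq_mul]
    refine (Finset.abs_sum_le_sum_abs _ _).trans (le_add_of_nonneg_of_le zero_le_one ?_)
    refine Finset.sum_le_sum fun i _ => ?_
    rw [abs_mul]
    exact mul_le_of_le_one_right (abs_nonneg _) (hF i x)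
  cases k with
  | zero =>
    refine key _ (fun i x => ?_) (h hg)
    simp only [embed]
    split_ifs with hi
    · exact abs_le.2 ⟨by linarith [x.2.1 ⟨i, hi⟩, show (0 : Fin p → ℝ) ⟨i, hi⟩ = 0 from rfl],
        x.2.2 ⟨i, hi⟩⟩
    · simp
    · simp
  | succ k =>
    obtain ⟨V', -, F, hF, hV⟩ := h
    refine key F (fun i x => ?_) (hV hg)
    obtain ⟨G, -, hG⟩ := hF i
    rw [hG]
    exact abs_euaf_le_one _

theorem Reach.raw {d p : ℕ} {k : ℕ} {V : Submodule ℝ (unitCube p → ℝ)} (h : Reach d p k V)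
    {ι : Type*} [Fintype ι] (hι : Fintype.card ι ≤ d) (G : ι → unitCube p → ℝ)
    (hG : ∀ i, G i ∈ V) :
    ∃ V', Reach d p (k + 1) V' ∧ ∀ i, (fun x => euaf (G i x)) ∈ V' := by
  obtain ⟨e⟩ : Nonempty (ι ↪ Fin d) :=
    Function.Embedding.nonempty_of_card_le (by simpa using hι)
  let F : Fin d → unitCube p → ℝ := fun i x => euaf (Function.extend e G 0 i x)
  refine ⟨Submodule.span ℝ (Set.range F), ⟨V, h, F, fun i => ⟨_, ?_, rfl⟩, le_rfl⟩, fun i => ?_⟩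
  · by_cases hi : ∃ j, e j = i
    · obtain ⟨j, rfl⟩ := hi
      rw [e.injective.extend_apply]
      exact hG j
    · rw [Function.extend_apply' _ _ _ hi]
      exact V.zero_mem
  · refine Submodule.subset_span ⟨e i, ?_⟩
    funext x
    simp only [F, e.injective.extend_apply]

/-- One hidden layer can at the same time carry functions, take absolute values, and apply the
activation function. -/
theorem Reach.layer {d p : ℕ} {k : ℕ} {V : Submodule ℝ (unitCube p → ℝ)} (h : Reach d p k V)
    (h1 : (fun _ => 1) ∈ V) {α β γ : Type*} [Fintype α] [Fintype β] [Fintype γ]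
    (hcard : 1 + Fintype.card α + Fintype.card β + Fintype.card γ ≤ d)
    (a : α → unitCube p → ℝ) (b : β → unitCube p → ℝ) (c : γ → unitCube p → ℝ)
    (ha : ∀ i, a i ∈ V) (hb : ∀ i, b i ∈ V) (hc : ∀ i, c i ∈ V) :
    ∃ V', Reach d p (k + 1) V' ∧ (fun _ => 1) ∈ V' ∧ (∀ i, a i ∈ V') ∧
      (∀ i, (fun x => |b i x|) ∈ V') ∧ ∀ i, (fun x => euaf (c i x)) ∈ V' := by
  choose A hA0 hA using fun i => h.bounded (ha i)
  choose B hB0 hB using fun i => h.bounded (hb i)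
  obtain ⟨V', hV', hG⟩ := h.raw (ι := Unit ⊕ α ⊕ β ⊕ γ)
    (by simpa [add_assoc] using hcard)
    (Sum.elim (fun _ _ => 1) (Sum.elim (fun i => (1 / (2 * A i)) • a i + (1 / 2 : ℝ) • fun _ => 1)
      (Sum.elim (fun i => (1 / B i) • b i + fun _ => 1) c)))
    (by
      rintro (_ | i | i | i)
      · exact h1
      · exact V.add_mem (V.smul_mem _ (ha i)) (V.smul_mem _ h1)
      · exact V.add_mem (V.smul_mem _ (hb i)) h1
      · exact hc i)
  have h1' : (fun _ => 1) ∈ V' := by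
    convert hG (Sum.inl ()) using 1
    funext x
    exact (euaf_of_mem_Icc zero_le_one le_rfl).symm
  refine ⟨V', hV', h1', fun i => ?_, fun i => ?_, fun i => hG (Sum.inr (Sum.inr (Sum.inr i)))⟩
  · have := hG (Sum.inr (Sum.inl i))
    convert V'.sub_mem (V'.smul_mem (2 * A i) this) (V'.smul_mem (A i) h1') using 1
    funext x
    have hA := abs_le.1 (hA i x)
    have hA0 := hA0 i
    have e : 1 / (2 * A i) * a i x + 1 / 2 * 1 = (a i x + A i) / (2 * A i) := by
      field_simp
    simp only [Sum.elim_inr, Sum.elim_inl, Pi.add_apply, Pi.smul_apply, Pi.sub_apply, smul_eq_mul]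
    rw [e, euaf_of_mem_Icc (div_nonneg (by linarith) (by linarith))
      ((div_le_one (by linarith)).2 (by linarith))]
    field_simp
    ring
  · have := hG (Sum.inr (Sum.inr (Sum.inl i)))
    convert V'.smul_mem (B i) (V'.sub_mem h1' this) using 1
    funext x
    have hB := hB i x
    have hB0 := hB0 i
    have e : |1 / B i * b i x| = |b i x| / B i := by
      rw [abs_mul, abs_of_pos (by positivity)]
      ring
    simp only [Sum.elim_inr, Sum.elim_inl, Pi.add_apply, Pi.smul_apply, Pi.sub_apply, smul_eq_mul]
    rw [euaf_add_one (by rw [e]; exact (div_le_one hB0).2 hB), e]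
    field_simp
    ring

theorem Reach.carry {d p : ℕ} {k : ℕ} {V : Submodule ℝ (unitCube p → ℝ)} (h : Reach d p k V)
    (h1 : (fun _ => 1) ∈ V) (hd : 2 ≤ d) {g : unitCube p → ℝ} (hg : g ∈ V) :
    ∀ m, ∃ V', Reach d p (k + m) V' ∧ (fun _ => 1) ∈ V' ∧ g ∈ V'
  | 0 => ⟨V, h, h1, hg⟩
  | m + 1 => by
    obtain ⟨V', hV', h1', hg'⟩ := h.carry h1 hd hg m
    obtain ⟨V'', hV'', h1'', hg'', -⟩ := hV'.layer h1' (α := Unit) (β := Empty) (γ := Empty)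
      (by simpa using hd) (fun _ => g) Empty.elim Empty.elim (fun _ => hg') (by simp) (by simp)
    exact ⟨V'', hV'', h1'', hg'' ()⟩

/-! ### Staircases, tents and labels -/

section Construction

/-- Signed, rescaled distance to the nearest integer. -/
noncomputable def quad (δ v : ℝ) : ℝ := (1 / 2 - euaf (v + 1 / 2)) / δ

/-- A continuous function agreeing with the floor function away from the integers. -/
noncomputable def stairs (δ v : ℝ) : ℝ :=
  v - |euaf v - (1 + |quad δ v| - |quad δ v - 1|) / 2|

/-- A nonnegative function measuring the proximity of `v` to the integers. -/
noncomputable def defect (δ v : ℝ) : ℝ := (|quad δ v + 2| + |quad δ v - 2|) / 2 - |quad δ v|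

theorem quad_cases {δ v : ℝ} (hv : 0 ≤ v) :
    (euaf v = v - ⌊v⌋₊ ∧ quad δ v = -(min (v - ⌊v⌋₊) (1 - (v - ⌊v⌋₊)) / δ)) ∨
      (euaf v = 1 - (v - ⌊v⌋₊) ∧ quad δ v = min (v - ⌊v⌋₊) (1 - (v - ⌊v⌋₊)) / δ) := by
  have h0 := Nat.floor_le hv
  have h1 := Nat.lt_floor_add_one v
  have h := euaf_cell ⌊v⌋₊ (r := v - ⌊v⌋₊) (by linarith) (by linarith)
  rw [add_sub_cancel] at h
  rcases h with ⟨e1, e2⟩ | ⟨e1, e2⟩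
  · exact Or.inl ⟨e1, by rw [quad, e2]; ring⟩
  · exact Or.inr ⟨e1, by rw [quad, e2]; ring⟩

theorem stairs_eq {δ v : ℝ} (hδ : 0 < δ) (hv : 0 ≤ v) (hs : 1 ≤ |quad δ v|) :
    stairs δ v = ⌊v⌋₊ := by
  have h0 := Nat.floor_le hv
  have h1 := Nat.lt_floor_add_one v
  have hm : 0 ≤ min (v - ⌊v⌋₊) (1 - (v - ⌊v⌋₊)) / δ :=
    div_nonneg (le_min (by linarith) (by linarith)) hδ.le
  rw [stairs]
  rcases quad_cases (δ := δ) hv with ⟨e1, e2⟩ | ⟨e1, e2⟩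
  · have hq : quad δ v ≤ 0 := by linarith
    rw [abs_of_nonpos hq, abs_of_nonpos (by linarith : quad δ v - 1 ≤ 0), e1,
      show v - ⌊v⌋₊ - (1 + -quad δ v - -(quad δ v - 1)) / 2 = v - ⌊v⌋₊ by ring,
      abs_of_nonneg (by linarith)]
    ring
  · have hq : 0 ≤ quad δ v := by linarith
    rw [abs_of_nonneg hq] at hs ⊢
    rw [abs_of_nonneg (by linarith : 0 ≤ quad δ v - 1), e1,
      show 1 - (v - ⌊v⌋₊) - (1 + quad δ v - (quad δ v - 1)) / 2 = -(v - ⌊v⌋₊) by ring,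
      abs_neg, abs_of_nonneg (by linarith)]
    ring

theorem sub_one_le_stairs (δ : ℝ) {v : ℝ} (hv : 0 ≤ v) : v - 1 ≤ stairs δ v := by
  have h0 := euaf_nonneg hv
  have h1 := (abs_le.1 (abs_euaf_le_one v)).2
  have h2 : |quad δ v| ≤ |quad δ v - 1| + 1 := by
    simpa using abs_add_le (quad δ v - 1) 1
  have h3 : |quad δ v - 1| ≤ |quad δ v| + 1 := by
    simpa using abs_sub (quad δ v) 1
  rw [stairs]
  have : |euaf v - (1 + |quad δ v| - |quad δ v - 1|) / 2| ≤ 1 := by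
    rw [abs_le]
    constructor <;> linarith
  linarith

theorem exists_int_near {δ v : ℝ} (hδ : 0 < δ) (hv : 0 ≤ v) (hs : |quad δ v| < 2) :
    ∃ m : ℤ, |v - m| < 2 * δ := by
  have h0 := Nat.floor_le hv
  have h1 := Nat.lt_floor_add_one v
  have hm0 : 0 ≤ min (v - ⌊v⌋₊) (1 - (v - ⌊v⌋₊)) := le_min (by linarith) (by linarith)
  have hm : min (v - ⌊v⌋₊) (1 - (v - ⌊v⌋₊)) < 2 * δ := by
    rw [← div_lt_iff₀ hδ, ← abs_of_nonneg (div_nonneg hm0 hδ.le)]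
    rcases quad_cases (δ := δ) hv with ⟨-, e⟩ | ⟨-, e⟩
    · rwa [e, abs_neg] at hs
    · rwa [e] at hs
  rcases min_lt_iff.1 hm with h | h
  · exact ⟨⌊v⌋₊, by rw [Int.cast_natCast, abs_of_nonneg (by linarith)]; exact h⟩
  · refine ⟨⌊v⌋₊ + 1, ?_⟩
    push_cast
    rw [abs_of_nonpos (by linarith)]
    linarith

theorem defect_nonneg (δ v : ℝ) : 0 ≤ defect δ v := by
  have := abs_add_le (quad δ v + 2) (quad δ v - 2)
  rw [show quad δ v + 2 + (quad δ v - 2) = 2 * quad δ v by ring, abs_mul, abs_two] at this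
  rw [defect]
  linarith

theorem defect_eq_zero {δ v : ℝ} (h : 2 ≤ |quad δ v|) : defect δ v = 0 := by
  rw [defect]
  rcases le_abs.1 h with h | h
  · rw [abs_of_nonneg (by linarith : 0 ≤ quad δ v), abs_of_nonneg (by linarith),
      abs_of_nonneg (by linarith)]
    ring
  · rw [abs_of_nonpos (by linarith : quad δ v ≤ 0), abs_of_nonpos (by linarith),
      abs_of_nonpos (by linarith)]
    ring

theorem one_lt_abs_quad {δ v : ℝ} (h : defect δ v < 1) : 1 < |quad δ v| := by
  rw [defect] at h
  have h1 := le_abs_self (quad δ v + 2)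
  have h2 := neg_abs_le (quad δ v - 2)
  linarith

/-- The coordinate `ξ` measured in the `q`-th shifted grid. -/
noncomputable def shift (p : ℕ) (M : ℝ) (q : ℕ) (ξ : ℝ) : ℝ := M * ξ + 1 + q / (p + 1)

/-- The relative half-width of the transition zones between cells. -/
noncomputable def gap (p : ℕ) : ℝ := 1 / (4 * (p + 1))

variable {p : ℕ}

/-- The number of the cell of the `q`-th grid containing `x`. -/
noncomputable def cellIndex (M : ℝ) (K q : ℕ) (x : Fin p → ℝ) : ℝ :=
  ∑ j : Fin p, (K : ℝ) ^ (j : ℕ) * stairs (gap p) (shift p M q (x j))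

noncomputable def slack (M : ℝ) (q : ℕ) (x : Fin p → ℝ) : ℝ :=
  1 - ∑ j, defect (gap p) (shift p M q (x j))

/-- A function supported where `cellIndex` is locally constant. -/
noncomputable def tent (M : ℝ) (q : ℕ) (x : Fin p → ℝ) : ℝ := (slack M q x + |slack M q x|) / 2

noncomputable def tentSum (M : ℝ) (q : ℕ) (x : Fin p → ℝ) : ℝ := ∑ r ∈ Finset.range q, tent M r x

/-- The minimum of `1` and `T`. -/
noncomputable def cap (T : ℝ) : ℝ := (1 + T - |1 - T|) / 2

/-- A partition of unity subordinate to the supports of the functions `tent M q`. -/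
noncomputable def blend (M : ℝ) (q : ℕ) (x : Fin p → ℝ) : ℝ :=
  cap (tentSum M (q + 1) x) - cap (tentSum M q x)

/-- A function with prescribed approximate values on the cells of the `q`-th grid. -/
noncomputable def label (M : ℝ) (K : ℕ) (a w : ℕ → ℝ) (q : ℕ) (x : Fin p → ℝ) : ℝ :=
  euaf (w q * (1 / (a q + cellIndex M K q x)))

noncomputable def approximant (M : ℝ) (K : ℕ) (a w : ℕ → ℝ) (A : ℝ) (x : Fin p → ℝ) : ℝ :=
  ∑ q ∈ Finset.range (p + 1), (approxSq A (label M K a w q x + blend M q x)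
    - approxSq A (label M K a w q x - blend M q x)) / 4

theorem cap_eq_min (T : ℝ) : cap T = min 1 T := by
  rw [cap]
  rcases le_total 1 T with h | h
  · rw [min_eq_left h, abs_of_nonpos (by linarith)]
    ring
  · rw [min_eq_right h, abs_of_nonneg (by linarith)]
    ring

theorem gap_pos (p : ℕ) : 0 < gap p := by
  rw [gap]
  positivity

theorem one_le_shift {M : ℝ} (hM : 0 ≤ M) (q : ℕ) {ξ : ℝ} (hξ : 0 ≤ ξ) : 1 ≤ shift p M q ξ := by
  have h1 : 0 ≤ M * ξ := mul_nonneg hM hξ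
  have h2 : (0 : ℝ) ≤ q / (p + 1) := by positivity
  rw [shift]
  linarith

theorem cellIndex_nonneg {M : ℝ} (hM : 0 ≤ M) (K q : ℕ) {x : Fin p → ℝ} (hx : x ∈ unitCube p) :
    0 ≤ cellIndex M K q x := by
  refine Finset.sum_nonneg fun j _ => mul_nonneg (by positivity) ?_
  have h := one_le_shift (p := p) hM q (hx.1 j)
  linarith [sub_one_le_stairs (gap p) (v := shift p M q (x j)) (by linarith)]

theorem exists_forall_two_le_abs_quad {M : ℝ} (hM : 0 ≤ M) {x : Fin p → ℝ}
    (hx : x ∈ unitCube p) :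
    ∃ q < p + 1, ∀ j, 2 ≤ |quad (gap p) (shift p M q (x j))| := by
  by_contra! hcon
  have hcon' : ∀ q : Fin (p + 1), ∃ j, |quad (gap p) (shift p M q (x j))| < 2 :=
    fun q => hcon q q.isLt
  choose J hJ using hcon'
  obtain ⟨q, q', hne, hqq⟩ := Fintype.exists_ne_map_eq_of_card_lt J (by simp)
  have hpos : ∀ q : ℕ, 0 ≤ shift p M q (x (J q')) := fun q => by
    linarith [one_le_shift (p := p) hM q (hx.1 (J q'))]
  have h1 := hJ q
  rw [hqq] at h1
  obtain ⟨m, hm⟩ := exists_int_near (gap_pos p) (hpos q) h1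
  obtain ⟨m', hm'⟩ := exists_int_near (gap_pos p) (hpos q') (hJ q')
  have hp : (0 : ℝ) < p + 1 := by positivity
  have hgap : gap p * (4 * (p + 1)) = 1 := by rw [gap]; field_simp
  have hlt : |((q : ℕ) : ℝ) - (q' : ℕ) - (m - m') * (p + 1)| < 1 := by
    have e : ((q : ℕ) : ℝ) - (q' : ℕ) - (m - m') * (p + 1)
        = ((shift p M q (x (J q')) - m) - (shift p M q' (x (J q')) - m')) * (p + 1) := by
      rw [shift, shift]
      field_simp
      ring
    rw [e, abs_mul, abs_of_pos hp]
    have := abs_sub (shift p M q (x (J q')) - m) (shift p M q' (x (J q')) - m')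
    calc _ < (2 * gap p + 2 * gap p) * (p + 1) := by
          apply mul_lt_mul_of_pos_right _ hp
          linarith
      _ = 1 := by linarith
  have hint : ((q : ℕ) : ℤ) - (q' : ℕ) - (m - m') * (p + 1) = 0 := by
    rw [← Int.abs_lt_one_iff]
    exact_mod_cast hlt
  have hq := q.isLt
  have hq' := q'.isLt
  have hmm : m - m' = 0 := by
    rw [← Int.abs_lt_one_iff, abs_lt]
    constructor <;> by_contra! hc <;> nlinarith
  rw [hmm] at hint
  exact hne (Fin.ext (by omega))

theorem tent_nonneg (M : ℝ) (q : ℕ) (x : Fin p → ℝ) : 0 ≤ tent M q x := by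
  rw [tent]
  linarith [neg_abs_le (slack M q x)]

theorem one_lt_abs_quad_of_tent_ne_zero {M : ℝ} {q : ℕ} {x : Fin p → ℝ} (h : tent M q x ≠ 0)
    (j : Fin p) : 1 < |quad (gap p) (shift p M q (x j))| := by
  apply one_lt_abs_quad
  by_contra! hc
  apply h
  have := Finset.single_le_sum (f := fun j => defect (gap p) (shift p M q (x j)))
    (fun j _ => defect_nonneg _ _) (Finset.mem_univ j)
  have hs : slack M q x ≤ 0 := by
    rw [slack]
    linarith
  rw [tent, abs_of_nonpos hs]
  ring

theorem blend_eq_zero {M : ℝ} {q : ℕ} {x : Fin p → ℝ} (h : tent M q x = 0) :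
    blend M q x = 0 := by
  rw [blend, tentSum, tentSum, Finset.sum_range_succ, h, add_zero, sub_self]

theorem blend_mem_Icc (M : ℝ) (q : ℕ) (x : Fin p → ℝ) : 0 ≤ blend M q x ∧ blend M q x ≤ 1 := by
  have h : tentSum M q x ≤ tentSum M (q + 1) x := by
    rw [tentSum, tentSum, Finset.sum_range_succ]
    linarith [tent_nonneg M q x]
  have h0 : 0 ≤ tentSum M q x := Finset.sum_nonneg fun r _ => tent_nonneg M r x
  rw [blend, cap_eq_min, cap_eq_min]
  have h1 : min 1 (tentSum M q x) ≤ min 1 (tentSum M (q + 1) x) := min_le_min_left _ h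
  have h2 : min 1 (tentSum M (q + 1) x) ≤ 1 := min_le_left _ _
  have h3 : 0 ≤ min 1 (tentSum M q x) := le_min zero_le_one h0
  constructor <;> linarith

theorem sum_blend {M : ℝ} (hM : 0 ≤ M) {x : Fin p → ℝ} (hx : x ∈ unitCube p) :
    ∑ q ∈ Finset.range (p + 1), blend M q x = 1 := by
  obtain ⟨q, hq, hj⟩ := exists_forall_two_le_abs_quad hM hx
  have htent : tent M q x = 1 := by
    rw [tent, slack, Finset.sum_eq_zero fun j _ => defect_eq_zero (hj j)]
    norm_num
  have h1 : 1 ≤ tentSum M (p + 1) x := htent ▸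
    Finset.single_le_sum (f := fun r => tent M r x) (fun r _ => tent_nonneg M r x)
      (Finset.mem_range.2 hq)
  simp only [blend]
  rw [Finset.sum_range_sub (fun q => cap (tentSum M q x)), cap_eq_min, cap_eq_min,
    min_eq_left h1]
  simp [tentSum]

theorem digits_lt {K : ℕ} {κ : Fin p → ℕ} (h : ∀ j, κ j < K) : ∑ j, κ j * K ^ (j : ℕ) < K ^ p := by
  have := (finFunctionFinEquiv (m := K) (n := p) fun j => ⟨κ j, h j⟩).isLt
  rwa [finFunctionFinEquiv_apply] at this

theorem digits_injective {K : ℕ} {κ κ' : Fin p → ℕ} (h : ∀ j, κ j < K) (h' : ∀ j, κ' j < K)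
    (e : ∑ j, κ j * K ^ (j : ℕ) = ∑ j, κ' j * K ^ (j : ℕ)) (j : Fin p) : κ j = κ' j := by
  have := (finFunctionFinEquiv (m := K) (n := p)).injective
    (a₁ := fun j => ⟨κ j, h j⟩) (a₂ := fun j => ⟨κ' j, h' j⟩)
    (Fin.ext (by simpa only [finFunctionFinEquiv_apply] using e))
  simpa using congrFun this j

theorem exists_label {M : ℝ} (hM : 0 ≤ M) {ρ η : ℝ} (hρ : 1 ≤ M * ρ) (hη : 0 < η)
    {f : (Fin p → ℝ) → ℝ} (hf01 : ∀ x ∈ unitCube p, 0 ≤ f x ∧ f x ≤ 1)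
    (hf : ∀ x ∈ unitCube p, ∀ x' ∈ unitCube p, (∀ j, |x j - x' j| < ρ) → |f x - f x'| ≤ η) :
    ∃ (K : ℕ) (a w : ℕ → ℝ), (∀ q, 1 ≤ a q) ∧ (∀ q, 0 ≤ w q) ∧
      ∀ x ∈ unitCube p, ∀ q < p + 1, tent M q x ≠ 0 → |label M K a w q x - f x| ≤ 2 * η := by
  classical
  have hM0 : 0 < M := by
    rcases hM.eq_or_lt with rfl | h
    · norm_num at hρ
    · exact h
  let K := ⌈M⌉₊ + 4
  let cell : ℕ → (Fin p → ℝ) → Fin p → ℕ := fun q x j => ⌊shift p M q (x j)⌋₊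
  let num : ℕ → (Fin p → ℝ) → ℕ := fun q x => ∑ j, cell q x j * K ^ (j : ℕ)
  have hcell : ∀ q < p + 1, ∀ x ∈ unitCube p, ∀ j, cell q x j < K := by
    intro q hq x hx j
    simp only [cell, K]
    rw [Nat.floor_lt (by linarith [one_le_shift (p := p) hM q (hx.1 j)])]
    have h1 : M * x j ≤ M := mul_le_of_le_one_right hM (hx.2 j)
    have h2 : (q : ℝ) / (p + 1) < 1 := by
      rw [div_lt_one (by positivity)]
      exact_mod_cast hq
    have h3 := Nat.le_ceil M
    rw [shift]
    push_cast
    linarith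
  let y : ℕ → ℕ → ℝ := fun q n =>
    if h : ∃ x ∈ unitCube p, num q x = n then f h.choose else 0
  have hy : ∀ q n, 0 ≤ y q n ∧ y q n ≤ 1 := by
    intro q n
    simp only [y]
    split_ifs with h
    · exact hf01 _ h.choose_spec.1
    · simp
  choose a w ha hw haw using fun q =>
    exists_euaf_fit (K ^ p) (y q) (fun n _ => hy q n) hη
  refine ⟨K, a, w, ha, hw, fun x hx q hq ht => ?_⟩
  have hidx : cellIndex M K q x = (num q x : ℝ) := by
    simp only [cellIndex, num]
    push_cast
    refine Finset.sum_congr rfl fun j _ => ?_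
    rw [stairs_eq (gap_pos p) (by linarith [one_le_shift (p := p) hM q (hx.1 j)])
      (one_lt_abs_quad_of_tent_ne_zero ht j).le, mul_comm]
  have h1 := haw q (num q x) (digits_lt (hcell q hq x hx))
  have hex : ∃ x' ∈ unitCube p, num q x' = num q x := ⟨x, hx, rfl⟩
  have h2 : |y q (num q x) - f x| ≤ η := by
    simp only [y]
    rw [dif_pos hex]
    have hx' := hex.choose_spec
    set x' := hex.choose
    refine hf _ hx'.1 _ hx fun j => ?_
    have hfl : ⌊shift p M q (x' j)⌋₊ = ⌊shift p M q (x j)⌋₊ :=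
      digits_injective (hcell q hq x' hx'.1) (hcell q hq x hx) hx'.2 j
    have b1 := Nat.floor_le (zero_le_one.trans (one_le_shift (p := p) hM q (hx.1 j)))
    have b2 := Nat.lt_floor_add_one (shift p M q (x j))
    have b3 := Nat.floor_le (zero_le_one.trans (one_le_shift (p := p) hM q (hx'.1.1 j)))
    have b4 := Nat.lt_floor_add_one (shift p M q (x' j))
    rw [hfl] at b3 b4
    have b5 : |shift p M q (x' j) - shift p M q (x j)| < 1 := by
      rw [abs_lt]
      constructor <;> linarith
    rw [show shift p M q (x' j) - shift p M q (x j) = M * (x' j - x j) by rw [shift, shift]; ring,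
      abs_mul, abs_of_pos hM0] at b5
    exact lt_of_mul_lt_mul_left (b5.trans_le hρ) hM
  rw [label, hidx]
  have := abs_sub_le (euaf (w q * (1 / (a q + (num q x : ℝ))))) (y q (num q x)) (f x)
  linarith

theorem label_mem_Icc {M : ℝ} (hM : 0 ≤ M) (K : ℕ) {a w : ℕ → ℝ} (ha : ∀ q, 1 ≤ a q)
    (hw : ∀ q, 0 ≤ w q) (q : ℕ) {x : Fin p → ℝ} (hx : x ∈ unitCube p) :
    0 ≤ label M K a w q x ∧ label M K a w q x ≤ 1 := by
  have h1 := cellIndex_nonneg hM K q hx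
  have h2 := ha q
  have h3 : 0 < a q + cellIndex M K q x := by linarith
  exact ⟨euaf_nonneg (mul_nonneg (hw q) (by positivity)), (abs_le.1 (abs_euaf_le_one _)).2⟩

theorem exists_approximant {η : ℝ} (hη : 0 < η)
    {f : (Fin p → ℝ) → ℝ} (hf01 : ∀ x ∈ unitCube p, 0 ≤ f x ∧ f x ≤ 1)
    (hf : ContinuousOn f (unitCube p)) :
    ∃ (M : ℝ) (K : ℕ) (a w : ℕ → ℝ) (A : ℝ), 0 ≤ M ∧ (∀ q, 1 ≤ a q) ∧ (∀ q, 0 ≤ w q) ∧ 4 ≤ A ∧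
      ∀ x ∈ unitCube p, |approximant M K a w A x - f x| ≤ η := by
  have hp : (0 : ℝ) < p + 1 := by positivity
  have huc := isCompact_Icc.uniformContinuousOn_of_continuous hf
  obtain ⟨ρ, hρ, hfρ⟩ := Metric.uniformContinuousOn_iff.1 huc (η / 4) (by positivity)
  have hM : (0 : ℝ) ≤ 1 / ρ := by positivity
  obtain ⟨K, a, w, ha, hw, hlab⟩ := exists_label hM (ρ := ρ) (η := η / 4)
    (by rw [one_div_mul_cancel hρ.ne']) (by positivity) hf01 (fun x hx x' hx' h => by
      have := hfρ x hx x' hx' ((dist_pi_lt_iff hρ).2 fun j => by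
        rw [Real.dist_eq]; exact h j)
      rw [Real.dist_eq] at this
      exact this.le)
  obtain ⟨A, hA, hmul⟩ := exists_approxMul (ε := η / 2 / (p + 1)) (by positivity)
  refine ⟨1 / ρ, K, a, w, A, hM, ha, hw, hA, fun x hx => ?_⟩
  set M := 1 / ρ
  have hsum := sum_blend hM hx
  have e : approximant M K a w A x - f x = ∑ q ∈ Finset.range (p + 1),
      (((approxSq A (label M K a w q x + blend M q x)
          - approxSq A (label M K a w q x - blend M q x)) / 4
          - label M K a w q x * blend M q x)
        + blend M q x * (label M K a w q x - f x)) := by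
    have : f x = ∑ q ∈ Finset.range (p + 1), blend M q x * f x := by
      rw [← Finset.sum_mul, hsum, one_mul]
    rw [this, approximant, ← Finset.sum_sub_distrib]
    refine Finset.sum_congr rfl fun q _ => ?_
    rw [← this]
    ring
  rw [e]
  have hterm : ∀ q ∈ Finset.range (p + 1), |((approxSq A (label M K a w q x + blend M q x)
          - approxSq A (label M K a w q x - blend M q x)) / 4
          - label M K a w q x * blend M q x)
        + blend M q x * (label M K a w q x - f x)|
      ≤ η / 2 / (p + 1) + blend M q x * (η / 2) := by
    intro q hq
    have hb := blend_mem_Icc M q x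
    have hl := label_mem_Icc hM K ha hw q hx
    refine (abs_add_le _ _).trans (add_le_add (hmul _ _ hl.1 hl.2 hb.1 hb.2) ?_)
    rw [abs_mul, abs_of_nonneg hb.1]
    by_cases ht : tent M q x = 0
    · simp [blend_eq_zero ht]
    · have := hlab x hx q (Finset.mem_range.1 hq) ht
      exact mul_le_mul_of_nonneg_left (by linarith) hb.1
  refine (Finset.abs_sum_le_sum_abs _ _).trans ((Finset.sum_le_sum hterm).trans ?_)
  rw [Finset.sum_add_distrib, ← Finset.sum_mul, hsum, Finset.sum_const, Finset.card_range,
    nsmul_eq_mul]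
  push_cast
  rw [mul_div_cancel₀ _ hp.ne']
  linarith

end Construction

/-! ### The approximant as a network -/

section Membership

variable {X : Type*} {V : Submodule ℝ (X → ℝ)} {f g : X → ℝ}

theorem mem_const (h1 : (fun _ => 1) ∈ V) (c : ℝ) : (fun _ => c) ∈ V := by
  convert V.smul_mem c h1 using 1
  funext x
  simp

theorem mem_add (hf : f ∈ V) (hg : g ∈ V) : (fun x => f x + g x) ∈ V := V.add_mem hf hg

theorem mem_sub (hf : f ∈ V) (hg : g ∈ V) : (fun x => f x - g x) ∈ V := V.sub_mem hf hg

theorem mem_neg (hf : f ∈ V) : (fun x => -f x) ∈ V := V.neg_mem hf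

theorem mem_const_mul (c : ℝ) (hf : f ∈ V) : (fun x => c * f x) ∈ V := V.smul_mem c hf

theorem mem_div_const (c : ℝ) (hf : f ∈ V) : (fun x => f x / c) ∈ V := by
  simpa only [div_eq_inv_mul] using mem_const_mul c⁻¹ hf

theorem mem_sum {ι : Type*} (s : Finset ι) {F : ι → X → ℝ} (hF : ∀ i ∈ s, F i ∈ V) :
    (fun x => ∑ i ∈ s, F i x) ∈ V := by
  convert V.sum_mem hF using 1
  funext x
  simp

end Membership

theorem exists_reach_approximant {d p : ℕ} (hdef : d = 36 * p * (2 * p + 1)) (hp : 0 < p)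
    {M : ℝ} (hM : 0 ≤ M) (K : ℕ) {a w : ℕ → ℝ} (ha : ∀ q, 1 ≤ a q) (hw : ∀ q, 0 ≤ w q)
    {A : ℝ} (hA : 4 ≤ A) :
    ∃ V, Reach d p 6 V ∧ (fun _ => 1) ∈ V ∧
      (fun x : unitCube p => approximant M K a w A x.1) ∈ V := by
  have hshift0 : ∀ q (x : unitCube p) j, 0 ≤ shift p M q (x.1 j) := fun q x j =>
    zero_le_one.trans (one_le_shift hM q (x.2.1 j))
  -- the input layer
  let V₀ : Submodule ℝ (unitCube p → ℝ) :=
    Submodule.span ℝ (Set.range fun (i : Fin d) (x : unitCube p) => embed d p x.1 i)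
  have r₀ : Reach d p 0 V₀ := le_refl V₀
  have hpd : p < d := by rw [hdef]; nlinarith
  have one₀ : (fun _ => 1) ∈ V₀ := Submodule.subset_span ⟨⟨p, hpd⟩, by funext x; simp [embed]⟩
  have coord₀ : ∀ j : Fin p, (fun x : unitCube p => x.1 j) ∈ V₀ := fun j =>
    Submodule.subset_span ⟨⟨j, j.isLt.trans hpd⟩, by funext x; simp [embed]⟩
  have shift_mem : ∀ {V : Submodule ℝ (unitCube p → ℝ)}, (fun _ => 1) ∈ V →
      (∀ j : Fin p, (fun x : unitCube p => x.1 j) ∈ V) → ∀ (q : ℕ) (j : Fin p),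
      (fun x : unitCube p => shift p M q (x.1 j)) ∈ V := fun h1 h q j =>
    mem_add (mem_add (mem_const_mul M (h j)) (mem_const h1 1)) (mem_const h1 _)
  -- triangle waves
  obtain ⟨V₁, r₁, one₁, coord₁, -, tri₁⟩ := r₀.layer one₀
    (α := Fin p) (β := Empty) (γ := (Fin (p + 1) × Fin p) × Bool)
    (by simp only [Fintype.card_prod, Fintype.card_fin, Fintype.card_bool, Fintype.card_empty]
        rw [hdef]; nlinarith)
    (fun j x => x.1 j) Empty.elim
    (fun i x => shift p M i.1.1 (x.1 i.1.2) + if i.2 then 1 / 2 else 0)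
    coord₀ (fun i => i.elim) (fun i => mem_add (shift_mem one₀ coord₀ _ _) (mem_const one₀ _))
  have wave₁ : ∀ (q : Fin (p + 1)) (j : Fin p),
      (fun x : unitCube p => euaf (shift p M q (x.1 j))) ∈ V₁ := fun q j => by
    simpa using tri₁ ((q, j), false)
  have quad₁ : ∀ (q : Fin (p + 1)) (j : Fin p),
      (fun x : unitCube p => quad (gap p) (shift p M q (x.1 j))) ∈ V₁ := fun q j => by
    have := tri₁ ((q, j), true)
    simp only [if_true] at this
    exact mem_div_const _ (mem_sub (mem_const one₁ _) this)
  -- square waves and defects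
  obtain ⟨V₂, r₂, one₂, carry₂, abs₂, -⟩ := r₁.layer one₁
    (α := Fin p ⊕ (Fin (p + 1) × Fin p)) (β := (Fin (p + 1) × Fin p) × Fin 4) (γ := Empty)
    (by simp only [Fintype.card_prod, Fintype.card_fin, Fintype.card_sum, Fintype.card_empty]
        rw [hdef]; nlinarith)
    (Sum.elim (fun j x => x.1 j) fun i x => euaf (shift p M i.1 (x.1 i.2)))
    (fun i x => quad (gap p) (shift p M i.1.1 (x.1 i.1.2)) + ![0, -1, 2, -2] i.2) Empty.elim
    (by
      rintro (j | i)
      · exact coord₁ j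
      · exact wave₁ _ _)
    (fun i => mem_add (quad₁ _ _) (mem_const one₁ _)) (fun i => i.elim)
  have coord₂ : ∀ j : Fin p, (fun x : unitCube p => x.1 j) ∈ V₂ := fun j => carry₂ (Sum.inl j)
  have abs₂0 : ∀ (q : Fin (p + 1)) (j : Fin p),
      (fun x : unitCube p => |quad (gap p) (shift p M q (x.1 j))|) ∈ V₂ := fun q j => by
    simpa using abs₂ ((q, j), 0)
  have abs₂1 : ∀ (q : Fin (p + 1)) (j : Fin p),
      (fun x : unitCube p => |quad (gap p) (shift p M q (x.1 j)) - 1|) ∈ V₂ := fun q j => by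
    simpa [← sub_eq_add_neg] using abs₂ ((q, j), 1)
  have abs₂2 : ∀ (q : Fin (p + 1)) (j : Fin p),
      (fun x : unitCube p => |quad (gap p) (shift p M q (x.1 j)) + 2|) ∈ V₂ := fun q j => by
    simpa using abs₂ ((q, j), 2)
  have abs₂3 : ∀ (q : Fin (p + 1)) (j : Fin p),
      (fun x : unitCube p => |quad (gap p) (shift p M q (x.1 j)) - 2|) ∈ V₂ := fun q j => by
    simpa [← sub_eq_add_neg] using abs₂ ((q, j), 3)
  have slack₂ : ∀ q : Fin (p + 1), (fun x : unitCube p => slack M q x.1) ∈ V₂ := fun q =>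
    mem_sub (mem_const one₂ 1) (mem_sum _ fun j _ =>
      mem_sub (mem_div_const 2 (mem_add (abs₂2 q j) (abs₂3 q j))) (abs₂0 q j))
  -- staircases and tents
  obtain ⟨V₃, r₃, one₃, carry₃, abs₃, -⟩ := r₂.layer one₂
    (α := Fin p ⊕ Fin (p + 1)) (β := Fin (p + 1) ⊕ (Fin (p + 1) × Fin p)) (γ := Empty)
    (by simp only [Fintype.card_prod, Fintype.card_fin, Fintype.card_sum, Fintype.card_empty]
        rw [hdef]; nlinarith)
    (Sum.elim (fun j x => x.1 j) fun q x => slack M q x.1)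
    (Sum.elim (fun q x => slack M q x.1) fun i x => euaf (shift p M i.1 (x.1 i.2))
      - (1 + |quad (gap p) (shift p M i.1 (x.1 i.2))|
        - |quad (gap p) (shift p M i.1 (x.1 i.2)) - 1|) / 2) Empty.elim
    (by
      rintro (j | q)
      · exact coord₂ j
      · exact slack₂ q)
    (by
      rintro (q | i)
      · exact slack₂ q
      · exact mem_sub (carry₂ (Sum.inr i)) (mem_div_const 2
          (mem_sub (mem_add (mem_const one₂ 1) (abs₂0 _ _)) (abs₂1 _ _))))
    (fun i => i.elim)
  have tent₃ : ∀ q < p + 1, (fun x : unitCube p => tent M q x.1) ∈ V₃ := fun q hq =>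
    mem_div_const 2 (mem_add (carry₃ (Sum.inr ⟨q, hq⟩)) (abs₃ (Sum.inl ⟨q, hq⟩)))
  have tentSum₃ : ∀ k < p + 2, (fun x : unitCube p => tentSum M k x.1) ∈ V₃ := fun k hk =>
    mem_sum _ fun q hq => tent₃ q (by have := Finset.mem_range.1 hq; omega)
  have cellIndex₃ : ∀ q : Fin (p + 1), (fun x : unitCube p => cellIndex M K q x.1) ∈ V₃ :=
    fun q => mem_sum _ fun j _ => mem_const_mul _
      (mem_sub (shift_mem one₃ (fun j => carry₃ (Sum.inl j)) q j) (abs₃ (Sum.inr (q, j))))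
  -- reciprocals and the partition of unity
  obtain ⟨V₄, r₄, one₄, carry₄, abs₄, raw₄⟩ := r₃.layer one₃
    (α := Fin (p + 1)) (β := Fin (p + 2)) (γ := Fin (p + 1))
    (by simp only [Fintype.card_fin]
        rw [hdef]; nlinarith)
    (fun q x => tent M q x.1) (fun k x => 1 - tentSum M k x.1)
    (fun q x => -(a q - 1 + cellIndex M K q x.1))
    (fun q => tent₃ q q.isLt) (fun k => mem_sub (mem_const one₃ 1) (tentSum₃ k k.isLt))
    (fun q => mem_neg (mem_add (mem_const one₃ _) (cellIndex₃ q)))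
  have cap₄ : ∀ k < p + 2, (fun x : unitCube p => cap (tentSum M k x.1)) ∈ V₄ := fun k hk =>
    mem_div_const 2 (mem_sub (mem_add (mem_const one₄ 1) (mem_sum _ fun q hq =>
      carry₄ ⟨q, by have := Finset.mem_range.1 hq; omega⟩)) (abs₄ ⟨k, hk⟩))
  have recip₄ : ∀ q : Fin (p + 1),
      (fun x : unitCube p => 1 / (a q + cellIndex M K q x.1)) ∈ V₄ := fun q => by
    convert mem_add (raw₄ q) (mem_const one₄ 1) using 1
    funext x
    rw [euaf_neg (by linarith [ha q, cellIndex_nonneg hM K q x.2])]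
    ring_nf
  -- labels
  obtain ⟨V₅, r₅, one₅, blend₅, -, label₅⟩ := r₄.layer one₄
    (α := Fin (p + 1)) (β := Empty) (γ := Fin (p + 1))
    (by simp only [Fintype.card_fin, Fintype.card_empty]
        rw [hdef]; nlinarith)
    (fun q x => blend M q x.1) Empty.elim
    (fun q x => w q * (1 / (a q + cellIndex M K q x.1)))
    (fun q => mem_sub (cap₄ _ (by omega)) (cap₄ _ (by omega))) (fun i => i.elim)
    (fun q => mem_const_mul _ (recip₄ q))
  -- products
  let sgn : Bool → ℝ := fun s => if s then 1 else -1
  obtain ⟨V₆, r₆, one₆, -, -, raw₆⟩ := r₅.layer one₅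
    (α := Empty) (β := Empty) (γ := (Fin (p + 1) × Bool) × Bool)
    (by simp only [Fintype.card_prod, Fintype.card_fin, Fintype.card_bool, Fintype.card_empty]
        rw [hdef]; nlinarith)
    Empty.elim Empty.elim
    (fun i x => -(A - 1 - sgn i.2 * (label M K a w i.1.1 x.1 + sgn i.1.2 * blend M i.1.1 x.1)))
    (fun i => i.elim) (fun i => i.elim)
    (fun i => mem_neg (mem_sub (mem_const one₅ _) (mem_const_mul _
      (mem_add (label₅ i.1.1) (mem_const_mul _ (blend₅ i.1.1))))))
  have sq₆ : ∀ (q : Fin (p + 1)) (s : Bool), (fun x : unitCube p =>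
      approxSq A (label M K a w q x.1 + sgn s * blend M q x.1)) ∈ V₆ := fun q s => by
    have h := fun t => mem_add (raw₆ ((q, s), t)) (mem_const one₆ 1)
    convert mem_sub (mem_const_mul (A ^ 3 / 2) (mem_add (h true) (h false)))
      (mem_const one₆ (A ^ 2)) using 1
    funext x
    have hl := label_mem_Icc hM K ha hw q x.2
    have hb := blend_mem_Icc M q x.1
    have hy : |label M K a w q x.1 + sgn s * blend M q x.1| ≤ 2 := by
      rw [abs_le]
      cases s <;> simp only [sgn, if_true, Bool.false_eq_true, if_false] <;>
        constructor <;> linarith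
    set y := label M K a w q x.1 + sgn s * blend M q x.1
    have hy' := abs_le.1 hy
    simp only [sgn, if_true, Bool.false_eq_true, if_false]
    rw [euaf_neg (by linarith), euaf_neg (by linarith), approxSq]
    ring_nf
  refine ⟨V₆, r₆, one₆, mem_sum _ fun q hq => mem_div_const 4 (mem_sub ?_ ?_)⟩
  · simpa [sgn] using sq₆ ⟨q, Finset.mem_range.1 hq⟩ true
  · simpa [sgn, ← sub_eq_add_neg] using sq₆ ⟨q, Finset.mem_range.1 hq⟩ false

theorem exists_vnetOut_approx {d p : ℕ} (hd : 0 < d) (hdef : d = 36 * p * (2 * p + 1))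
    (hp : 0 < p) {ε : ℝ} (hε : 0 < ε) {f : (Fin p → ℝ) → ℝ} (hf : ContinuousOn f (unitCube p)) :
    ∃ Ws : ℕ → Matrix (Fin d) (Fin d) ℝ,
      ∀ x ∈ unitCube p, |f x - vnetOut d euaf Ws (embed d p x) 12 ⟨0, hd⟩| ≤ ε := by
  obtain ⟨C, hC⟩ := isCompact_Icc.exists_bound_of_continuousOn hf
  set C' := |C| + 1 with hC'
  have hC0 : 0 < C' := by positivity
  have hfC : ∀ x ∈ unitCube p, |f x| ≤ C' := fun x hx => by
    have h1 := hC x hx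
    have h2 := le_abs_self C
    rw [Real.norm_eq_abs] at h1
    linarith
  obtain ⟨M, K, a, w, A, hM, ha, hw, hA, happ⟩ := exists_approximant
    (η := ε / (2 * C')) (by positivity) (f := fun x => (f x + C') / (2 * C'))
    (fun x hx => by
      have := abs_le.1 (hfC x hx)
      exact ⟨div_nonneg (by linarith) (by linarith),
        (div_le_one (by linarith)).2 (by linarith)⟩)
    ((hf.add continuousOn_const).div_const _)
  obtain ⟨V, hV, h1, hmem⟩ := exists_reach_approximant hdef hp hM K ha hw hA
  obtain ⟨V', hV', h1', hmem'⟩ := hV.carry h1 (by rw [hdef]; nlinarith) hmem 5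
  obtain ⟨Ws, hWs⟩ := hV'.exists_vnetOut_succ hd
    (mem_sub (mem_const_mul (2 * C') hmem') (mem_const h1' C'))
  refine ⟨Ws, fun x hx => ?_⟩
  have h := hWs ⟨x, hx⟩
  simp only at h
  rw [h]
  have e : f x - (2 * C' * approximant M K a w A x - C')
      = -(2 * C' * (approximant M K a w A x - (f x + C') / (2 * C'))) := by
    field_simp
    ring
  rw [e, abs_neg, abs_mul, abs_of_pos (by positivity : 0 < 2 * C')]
  calc _ ≤ 2 * C' * (ε / (2 * C')) := by gcongr; exact happ x hx
    _ = ε := by field_simp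

end PromptTF

/-- Universal approximation of continuous functions with short prompts:
with `d = 36p(2p+1)`, `L = 12`, `T = 24d`, any EUAF-transformer with the EUAF emulation
property approximates every continuous `f : [0,1]^p → ℝ` within `ε` via a prompt in
`Q_{ℝ^d}(24d, 12, S)`. -/
theorem statement_10 (p : ℕ) (hp : 0 < p) (ε : ℝ) (hε : 0 < ε)
    (d : ℕ) (hdef : d = 36 * p * (2 * p + 1))
    (Θ : List (TFLayer (4 * d + 8))) (hΘ : EmulatesWith d (tfForwardEUAF Θ) euaf) :
    ∀ f : (Fin p → ℝ) → ℝ, ContinuousOn f (unitCube p) →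
    ∀ δ : ℝ, 0 < δ →
      ∃ (S : ℝ) (T' : ℕ) (u : Fin T' → Fin d → ℝ) (w : Fin T' → ℕ),
        0 < S ∧ 1 ≤ T' ∧ T' ≤ 24 * d ∧ ValidPrompt Set.univ T' 12 u w ∧
        supDist p f (fhat (tfForwardEUAF Θ) u w S 12 p) ≤ ε + δ := by
  intro f hf δ hδ
  have hd : 0 < d := by rw [hdef]; positivity
  obtain ⟨Ws, hWs⟩ := exists_vnetOut_approx hd hdef hp hε hf
  obtain ⟨S, u, w, hS, hv, hu⟩ := exists_fhat_eq (p := p) hd hΘ Ws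
  refine ⟨S, 24 * d, u, w, hS, by omega, le_rfl, hv, ?_⟩
  have : Nonempty (unitCube p) := ⟨⟨0, le_rfl, zero_le_one⟩⟩
  refine ciSup_le fun x => ?_
  rw [hu x.1 x.2]
  linarith [hWs x.1 x.2]
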